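/- Let p be a prime, u ∈ ℚ_p a p-adic unit which is not a square in ℚ_p, and let L = ℚ_p(α) be the quadratic field extension of ℚ_p generated by an element α with α² = u, endowed with its canonical topology as a finite-dimensional ℚ_p-vector space (equivalently, its unique extension of the p-adic norm). Then the quotient topological group L^× / ℚ_p^×, the quotient of the unit group of L by the image of ℚ_p^× under the inclusion ℚ_p ⊆ L, is compact. -/

import Mathlib

/-- If `L` is a finite-dimensional normed field extension of a proper nontrivially normed field `K`,
then the quotient `Lˣ / Kˣ` is compact. -/
theorem compactSpace_units_quotient_range_map_algebraMap (K L : Type*) [NontriviallyNormedField K]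
    [ProperSpace K] [NormedField L] [NormedAlgebra K L] [FiniteDimensional K L] :
    CompactSpace (Lˣ ⧸ (Units.map (algebraMap K L).toMonoidHom).range) := by
  obtain ⟨c, hc⟩ := NormedField.exists_one_lt_norm K
  have hc0 : 0 < ‖c‖ := one_pos.trans hc
  have : ProperSpace L := FiniteDimensional.proper K L
  let shell : Set L := Metric.closedBall 0 1 ∩ {x | 1 / ‖c‖ ≤ ‖x‖}
  have hshell : IsCompact shell :=
    (isCompact_closedBall 0 1).inter_right (isClosed_le continuous_const continuous_norm)
  have hunits : IsCompact ((↑) ⁻¹' shell : Set Lˣ) := by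
    rw [Units.isEmbedding_val₀.isCompact_iff, Set.image_preimage_eq_of_subset]
    · exact hshell
    · rintro x ⟨-, hx⟩
      have hx0 : x ≠ 0 := norm_pos_iff.mp ((one_div_pos.mpr hc0).trans_le hx)
      exact ⟨Units.mk0 x hx0, rfl⟩
  refine ⟨(hunits.image QuotientGroup.continuous_mk).of_isClosed_subset isClosed_univ ?_⟩
  intro q _
  obtain ⟨x, rfl⟩ := QuotientGroup.mk_surjective q
  obtain ⟨d, hd, hlt, hle, -⟩ := rescale_to_shell hc one_pos x.ne_zero
  refine ⟨x * Units.map (algebraMap K L).toMonoidHom (Units.mk0 d hd), ?_, ?_⟩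
  · have hval : ((x * Units.map (algebraMap K L).toMonoidHom (Units.mk0 d hd) : Lˣ) : L)
        = d • (x : L) := by
      simp [Algebra.smul_def, mul_comm]
    rw [Set.mem_preimage, hval]
    exact ⟨mem_closedBall_zero_iff.mpr hlt.le, hle⟩
  · exact QuotientGroup.mk_mul_of_mem _ ⟨_, rfl⟩

/-- Let `p` be a prime, `u` a non-square `p`-adic unit and `L = ℚ_p(α)` the quadratic
extension of `ℚ_p` generated by a square root `α` of `u`, with its canonical topology
(coming from its norm extending the `p`-adic norm).  Then the quotient topological group
`L^× / ℚ_p^×` is compact. -/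
theorem stmt_11 (p : ℕ) [Fact p.Prime] (u : ℚ_[p]) (hu : ‖u‖ = 1)
    (hsq : ¬∃ v : ℚ_[p], v ^ 2 = u)
    (L : Type*) [NormedField L] [NormedAlgebra ℚ_[p] L] (α : L)
    (hα : α ^ 2 = algebraMap ℚ_[p] L u)
    (hgen : Algebra.adjoin ℚ_[p] ({α} : Set L) = ⊤) :
    CompactSpace (Lˣ ⧸ (Units.map (algebraMap ℚ_[p] L).toMonoidHom).range) := by
  have hint : IsIntegral ℚ_[p] α := .of_pow two_pos (hα ▸ isIntegral_algebraMap)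
  have : FiniteDimensional ℚ_[p] L := by
    refine ⟨?_⟩
    rw [← Algebra.top_toSubmodule, ← hgen]
    exact hint.fg_adjoin_singleton
  exact compactSpace_units_quotient_range_map_algebraMap ℚ_[p] L
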